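/- Let X be a real Hilbert space and let C ⊆ X be a nonempty unbounded closed convex subset satisfying at least one of the following conditions: (A) Int barc(C) ≠ ∅; (C) there exist r > 0 and a finite-dimensional linear subspace Z ⊆ X with C ⊆ B(0; r) + Z. Then C has the strong separation property if and only if the interior of C is nonempty and barc(C) = Int barc(C) ∪ {0}. -/

import Mathlib

open Pointwise

/-- The barrier cone of a set `C` in a normed space. -/
def barrierCone {X : Type*} [NormedAddCommGroup X] [NormedSpace ℝ X] (C : Set X) :
    Set (X →L[ℝ] ℝ) :=
  {f | ∃ b : ℝ, ∀ c ∈ C, f c ≤ b}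

/-- `C` and `D` are strongly separated. -/
def StronglySeparated {X : Type*} [NormedAddCommGroup X] [NormedSpace ℝ X]
    (C D : Set X) : Prop :=
  ∃ f : X →L[ℝ] ℝ, f ≠ 0 ∧ ∃ a b : ℝ, a < b ∧ (∀ c ∈ C, f c ≤ a) ∧ ∀ d ∈ D, b ≤ f d

/-- `C` has the strong separation property. -/
def StrongSepProperty {X : Type*} [NormedAddCommGroup X] [NormedSpace ℝ X]
    (C : Set X) : Prop :=
  ∀ D : Set X, D.Nonempty → IsClosed D → Convex ℝ D → Disjoint C D → StronglySeparated C D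

/-- Weak sequential compactness, along an ultrafilter. -/
lemma weak_limit {X : Type*} [NormedAddCommGroup X] [InnerProductSpace ℝ X]
    [CompleteSpace X] (U : Ultrafilter ℕ) (w : ℕ → X) (R : ℝ) (hw : ∀ n, ‖w n‖ ≤ R) :
    ∃ v : X, ∀ g : X →L[ℝ] ℝ, Filter.Tendsto (fun n => g (w n)) U (nhds (g v)) := by
  let T : ℕ → WeakDual ℝ X := fun n => StrongDual.toWeakDual (InnerProductSpace.toDual ℝ X (w n))
  have hc := WeakDual.isCompact_closedBall (𝕜 := ℝ) (E := X) 0 R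
  obtain ⟨φ, -, hφ⟩ := hc.ultrafilter_le_nhds (U.map T) (by
    rw [Filter.le_principal_iff]
    refine Filter.mem_map.2 (Filter.univ_mem' fun n => ?_)
    simp [T, hw n])
  refine ⟨(InnerProductSpace.toDual ℝ X).symm (WeakDual.toStrongDual φ), fun g => ?_⟩
  obtain ⟨y, rfl⟩ := (InnerProductSpace.toDual ℝ X).surjective g
  have h1 : Filter.Tendsto T U (nhds φ) := hφ
  have h2 := ((WeakDual.eval_continuous (𝕜 := ℝ) (E := X) y).tendsto φ).comp h1
  have e : (InnerProductSpace.toDual ℝ X y) ((InnerProductSpace.toDual ℝ X).symm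
      (WeakDual.toStrongDual φ)) = φ y := by
    rw [InnerProductSpace.toDual_apply_apply, real_inner_comm,
      InnerProductSpace.toDual_symm_apply]
    rfl
  rw [e]
  refine h2.congr fun n => ?_
  change inner ℝ (w n) y = inner ℝ y (w n)
  rw [real_inner_comm]

lemma weak_closed {X : Type*} [NormedAddCommGroup X] [InnerProductSpace ℝ X]
    (U : Ultrafilter ℕ) (C : Set X) (hcl : IsClosed C) (hconv : Convex ℝ C)
    (w : ℕ → X) (v : X) (hw : ∀ᶠ n in (U : Filter ℕ), w n ∈ C)
    (hv : ∀ g : X →L[ℝ] ℝ, Filter.Tendsto (fun n => g (w n)) U (nhds (g v))) : v ∈ C := by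
  by_contra h
  obtain ⟨g, u, h1, h2⟩ := geometric_hahn_banach_closed_point hconv hcl h
  have : g v ≤ u := le_of_tendsto (hv g) (hw.mono fun n hn => (h1 _ hn).le)
  linarith

lemma wellpos {X : Type*} [NormedAddCommGroup X] [InnerProductSpace ℝ X]
    [CompleteSpace X] (C : Set X) (f : X →L[ℝ] ℝ) (hf : f ∈ interior (barrierCone C))
    (s : ℝ) (hs : ∀ c ∈ C, f c ≤ s) :
    ∃ M : ℝ, 0 < M ∧ ∀ c ∈ C, ‖c‖ ≤ M * (1 + s - f c) := by
  let T : C → (X →L[ℝ] ℝ) →L[ℝ] ℝ := fun c =>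
    (1 + s - f c)⁻¹ • NormedSpace.inclusionInDoubleDualLi ℝ (E := X) (c : X)
  have hpos : ∀ c : C, 1 ≤ 1 + s - f c := fun c => by linarith [hs c c.2]
  obtain ⟨M, hM⟩ := banach_steinhaus (g := T) (by
    intro g
    have hcont : Filter.Tendsto (fun t : ℝ => f + t • g) (nhds 0) (nhds f) := by
      have : Continuous (fun t : ℝ => f + t • g) := by fun_prop
      simpa using this.tendsto 0
    have hev := hcont.eventually (mem_interior_iff_mem_nhds.1 hf)
    obtain ⟨ε, hε, hball⟩ := Metric.eventually_nhds_iff.1 hev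
    obtain ⟨b1, hb1⟩ := hball (y := ε / 2) (by simp [abs_of_pos hε]; linarith)
    obtain ⟨b2, hb2⟩ := hball (y := -(ε / 2)) (by simp [abs_of_pos hε]; linarith)
    refine ⟨(ε/2)⁻¹ * (1 + |b1 - s| + |b2 - s|), fun c => ?_⟩
    have e : T c g = (1 + s - f c)⁻¹ * g c := rfl
    have h1 := hb1 c c.2
    have h2 := hb2 c c.2
    simp only [ContinuousLinearMap.add_apply, ContinuousLinearMap.smul_apply, smul_eq_mul] at h1 h2
    have hp := hpos c
    have h0 : (0:ℝ) < 1 + s - f c := by linarith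
    have hg : (ε/2) * |g c| ≤ (1 + |b1 - s| + |b2 - s|) * (1 + s - f c) := by
      have k1 := le_abs_self (b1 - s)
      have k2 := le_abs_self (b2 - s)
      have k3 := abs_nonneg (b1 - s)
      have k4 := abs_nonneg (b2 - s)
      rcases abs_cases (g c) with ⟨h, _⟩ | ⟨h, _⟩ <;> rw [h] <;> nlinarith
    rw [e, Real.norm_eq_abs, abs_mul, abs_of_pos (inv_pos.2 h0), inv_mul_eq_div,
      inv_mul_eq_div, div_le_div_iff₀ h0 (by linarith)]
    linarith)
  refine ⟨|M| + 1, by positivity, fun c hc => ?_⟩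
  have h := hM ⟨c, hc⟩
  have hp := hpos ⟨c, hc⟩
  have h0 : (0:ℝ) < 1 + s - f c := by simp only at hp; linarith
  simp only [T, norm_smul, LinearIsometry.norm_map, norm_inv, Real.norm_eq_abs, abs_of_pos h0,
    inv_mul_eq_div] at h
  rw [div_le_iff₀ h0] at h
  nlinarith [le_abs_self M]

/-- Recession directions from unbounded sequences. -/
lemma recession {X : Type*} [NormedAddCommGroup X] [InnerProductSpace ℝ X]
    [CompleteSpace X]
    (C : Set X) (hcl : IsClosed C) (hconv : Convex ℝ C)
    (hcond :
      (interior (barrierCone C)).Nonempty ∨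
      (∃ r > (0 : ℝ), ∃ Z : Submodule ℝ X, FiniteDimensional ℝ Z ∧
        C ⊆ Metric.ball (0 : X) r + (Z : Set X)))
    (f : X →L[ℝ] ℝ)
    (hseq : ∀ n : ℕ, ∃ c ∈ C, (n : ℝ) + 1 ≤ ‖c‖ ∧ -(‖c‖ / (n + 1)) ≤ f c) :
    ∃ v : X, v ≠ 0 ∧ 0 ≤ f v ∧ ∀ c ∈ C, ∀ t : ℝ, 0 ≤ t → c + t • v ∈ C := by
  choose c hcC hcn hcf using hseq
  have hpos : ∀ n, 0 < ‖c n‖ := fun n => lt_of_lt_of_le (by positivity) (hcn n)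
  let U : Ultrafilter ℕ := Filter.hyperfilter ℕ
  have hU : (U : Filter ℕ) ≤ Filter.atTop := Nat.hyperfilter_le_atTop
  let w : ℕ → X := fun n => ‖c n‖⁻¹ • c n
  have hw1 : ∀ n, ‖w n‖ = 1 := fun n => by
    simp [w, norm_smul, (hpos n).ne']
  have hinf : Filter.Tendsto (fun n => ‖c n‖) Filter.atTop Filter.atTop := by
    refine Filter.tendsto_atTop_mono hcn ?_
    exact Filter.tendsto_atTop_add_const_right _ _ tendsto_natCast_atTop_atTop
  have hinv : Filter.Tendsto (fun n => ‖c n‖⁻¹) U (nhds 0) :=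
    (tendsto_inv_atTop_zero.comp hinf).mono_left hU
  have main : ∃ v : X, v ≠ 0 ∧
      ∀ g : X →L[ℝ] ℝ, Filter.Tendsto (fun n => g (w n)) U (nhds (g v)) := by
    rcases hcond with ⟨f0, hf0⟩ | ⟨r, hr, Z, hZ, hCZ⟩
    · obtain ⟨v, hv⟩ := weak_limit U w 1 (fun n => (hw1 n).le)
      refine ⟨v, ?_, hv⟩
      rintro rfl
      obtain ⟨s, hs⟩ := interior_subset hf0
      obtain ⟨M, hM, hMc⟩ := wellpos C f0 hf0 s hs
      have h1 : ∀ n, 1 ≤ M * ((1 + s) * ‖c n‖⁻¹ - f0 (w n)) := by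
        intro n
        have := hMc _ (hcC n)
        have e : M * ((1 + s) * ‖c n‖⁻¹ - f0 (w n)) = M * (1 + s - f0 (c n)) * ‖c n‖⁻¹ := by
          simp [w]; ring
        rw [e, ← div_eq_mul_inv, le_div_iff₀ (hpos n)]
        linarith
      have h2 : Filter.Tendsto (fun n => M * ((1 + s) * ‖c n‖⁻¹ - f0 (w n))) U
          (nhds (M * ((1 + s) * 0 - f0 0))) :=
        ((hinv.const_mul _).sub (hv f0)).const_mul _
      have := ge_of_tendsto' h2 h1
      simp at this
      linarith
    · have hdec : ∀ n, ∃ z : Z, ‖c n - z‖ < r := by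
        intro n
        obtain ⟨b, hb, z, hz, hbz⟩ := Set.mem_add.1 (hCZ (hcC n))
        refine ⟨⟨z, hz⟩, ?_⟩
        rw [← hbz]; simpa using hb
      choose z hz using hdec
      have hd : ∀ n, ‖w n - ((‖c n‖⁻¹ • z n : Z) : X)‖ ≤ r * ‖c n‖⁻¹ := by
        intro n
        have : w n - ((‖c n‖⁻¹ • z n : Z) : X) = ‖c n‖⁻¹ • (c n - z n) := by
          simp [w, smul_sub]
        rw [this, norm_smul, norm_inv, norm_norm, mul_comm]
        exact mul_le_mul_of_nonneg_right (hz n).le (inv_nonneg.2 (norm_nonneg _))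
      have hbd : ∀ n, ‖(‖c n‖⁻¹ • z n : Z)‖ ≤ 1 + r := by
        intro n
        have h1 := hd n
        have h2 : ‖((‖c n‖⁻¹ • z n : Z) : X)‖ ≤ ‖w n‖ + ‖w n - ((‖c n‖⁻¹ • z n : Z) : X)‖ := by
          have := norm_sub_le (w n) (w n - ((‖c n‖⁻¹ • z n : Z) : X))
          rwa [sub_sub_cancel] at this
        have h3 : ‖c n‖⁻¹ ≤ 1 := by
          apply inv_le_one_of_one_le₀
          have := hcn n
          have h0 : (0:ℝ) ≤ n := by positivity
          linarith
        rw [hw1] at h2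
        rw [← Submodule.norm_coe]
        nlinarith
      have : ProperSpace Z := FiniteDimensional.proper ℝ Z
      obtain ⟨v, -, hv⟩ := (isCompact_closedBall (0 : Z) (1 + r)).ultrafilter_le_nhds
        (U.map (fun n => ‖c n‖⁻¹ • z n)) (by
          rw [Filter.le_principal_iff]
          refine Filter.mem_map.2 (Filter.univ_mem' fun n => ?_)
          simpa using hbd n)
      have hv1 : Filter.Tendsto (fun n => ‖c n‖⁻¹ • z n) U (nhds v) := hv
      have hv2 : Filter.Tendsto (fun n => ((‖c n‖⁻¹ • z n : Z) : X)) U (nhds (v : X)) :=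
        (continuous_subtype_val.tendsto v).comp hv1
      have hv3 : Filter.Tendsto (fun n => w n - ((‖c n‖⁻¹ • z n : Z) : X)) U (nhds 0) := by
        refine squeeze_zero_norm hd ?_
        simpa using hinv.const_mul r
      have hv4 : Filter.Tendsto w U (nhds (v : X)) := by
        simpa using hv3.add hv2
      refine ⟨v, ?_, fun g => (g.continuous.tendsto _).comp hv4⟩
      intro h0
      have h5 := hv4.norm
      simp only [hw1, h0, norm_zero] at h5
      exact one_ne_zero (tendsto_nhds_unique tendsto_const_nhds h5)
  obtain ⟨v, hv0, hv⟩ := main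
  refine ⟨v, hv0, ?_, ?_⟩
  · have h1 : ∀ n : ℕ, -(1 / ((n : ℝ) + 1)) ≤ f (w n) := by
      intro n
      have := mul_le_mul_of_nonneg_left (hcf n) (inv_nonneg.2 (hpos n).le)
      have e : ‖c n‖⁻¹ * -(‖c n‖ / ((n:ℝ) + 1)) = -(1 / ((n : ℝ) + 1)) := by
        have := (hpos n).ne'
        field_simp
      rw [e] at this
      simpa [w] using this
    have h2 : Filter.Tendsto (fun n : ℕ => -(1 / ((n : ℝ) + 1))) U (nhds (-0)) :=
      (tendsto_one_div_add_atTop_nhds_zero_nat.mono_left hU).neg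
    have := le_of_tendsto_of_tendsto' h2 (hv f) h1
    simpa using this
  · intro x hx t ht
    refine weak_closed U C hcl hconv
      (fun n => (1 - t * ‖c n‖⁻¹) • x + (t * ‖c n‖⁻¹) • c n) _ ?_ ?_
    · have hev : ∀ᶠ n in (U : Filter ℕ), t * ‖c n‖⁻¹ < 1 := by
        have : Filter.Tendsto (fun n => t * ‖c n‖⁻¹) U (nhds 0) := by
          simpa using hinv.const_mul t
        exact this.eventually (gt_mem_nhds one_pos)
      refine hev.mono fun n hn => ?_
      exact hconv hx (hcC n) (by linarith) (mul_nonneg ht (inv_nonneg.2 (norm_nonneg _))) (by ring)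
    · intro g
      have h := (((tendsto_const_nhds (x := (1:ℝ))).sub (hinv.const_mul t)).mul_const (g x)).add
        ((hv g).const_mul t)
      have e : g (x + t • v) = (1 - t * 0) * g x + t * g v := by simp
      rw [e]
      refine h.congr fun n => ?_
      simp [w]
      ring

lemma exp_small (k p : ℝ) {η : ℝ} (hη : 0 < η) :
    ∃ n : ℝ, 0 ≤ n ∧ Real.exp (-(p + n)) * k < η := by
  have h : Filter.Tendsto (fun n : ℝ => Real.exp (-(p + n)) * k) Filter.atTop (nhds (0 * k)) := by
    refine Filter.Tendsto.mul_const _ ?_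
    exact Real.tendsto_exp_neg_atTop_nhds_zero.comp (Filter.tendsto_atTop_add_const_left _ _ Filter.tendsto_id)
  rw [zero_mul] at h
  obtain ⟨n, h1, h2⟩ := ((h.eventually (gt_mem_nhds hη)).and (Filter.eventually_ge_atTop 0)).exists
  exact ⟨n, h2, h1⟩

lemma part_barrier {X : Type*} [NormedAddCommGroup X] [InnerProductSpace ℝ X]
    (C : Set X) (hne : C.Nonempty) (hsep : StrongSepProperty C)
    (f : X →L[ℝ] ℝ) (hf : f ∈ barrierCone C) (hf0 : f ≠ 0)
    (v : X) (hv0 : v ≠ 0) (hfv : 0 ≤ f v)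
    (hv : ∀ c ∈ C, ∀ t : ℝ, 0 ≤ t → c + t • v ∈ C) : False := by
  have hle : ∀ g : X →L[ℝ] ℝ, ∀ b : ℝ, (∀ c ∈ C, g c ≤ b) → g v ≤ 0 := by
    intro g b hb
    by_contra! hlt
    obtain ⟨c, hc⟩ := hne
    have h1 := hb _ (hv c hc ((|b - g c| + 1) / g v) (by positivity))
    have h2 : ((|b - g c| + 1) / g v) * g v = |b - g c| + 1 := div_mul_cancel₀ _ hlt.ne'
    simp only [map_add, map_smul, smul_eq_mul, h2] at h1
    linarith [le_abs_self (b - g c)]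
  obtain ⟨b0, hb0⟩ := hf
  have hfv0 : f v = 0 := le_antisymm (hle f b0 hb0) hfv
  have hlub : IsLUB (f '' C) (sSup (f '' C)) := isLUB_csSup (hne.image f) ⟨b0, by
    rintro _ ⟨c, hc, rfl⟩; exact hb0 c hc⟩
  set s := sSup (f '' C)
  have hs : ∀ c ∈ C, f c ≤ s := fun c hc => hlub.1 ⟨c, hc, rfl⟩
  obtain ⟨t, ht⟩ : ∃ t : X →L[ℝ] ℝ, t v = 1 := by
    refine ⟨(‖v‖ ^ 2)⁻¹ • innerSL ℝ v, ?_⟩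
    have : ‖v‖ ≠ 0 := norm_ne_zero_iff.2 hv0
    simp [this]
  obtain ⟨u, hu1, hu2⟩ : ∃ u : X, f u = 1 ∧ t u = 0 := by
    obtain ⟨y, hy⟩ : ∃ y, f y ≠ 0 := by
      by_contra! h
      exact hf0 (ContinuousLinearMap.ext h)
    refine ⟨(f y)⁻¹ • y - t ((f y)⁻¹ • y) • v, ?_, ?_⟩
    · simp [hfv0, hy]
    · simp [ht]
  have hD := hsep {x | s + Real.exp (-(t x)) ≤ f x} ?_ ?_ ?_ ?_
  · obtain ⟨g, -, a, b, hab, hga, hgb⟩ := hD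
    have hgv := hle g a hga
    obtain ⟨η, hη, hηb⟩ : ∃ η > 0, η * |g u| < (b - a) / 2 := by
      refine ⟨(b - a) / 2 / (|g u| + 1), by have := sub_pos.2 hab; positivity, ?_⟩
      rw [div_mul_eq_mul_div, div_lt_iff₀ (by positivity)]
      nlinarith [abs_nonneg (g u)]
    obtain ⟨_, ⟨c, hc, rfl⟩, hcs⟩ := (lt_isLUB_iff hlub).1 (sub_lt_self s hη)
    obtain ⟨n, hn, hnb⟩ := exp_small (g u) (t c) (η := (b - a) / 2) (by linarith)
    have h1 := hgb (c + (s - f c + Real.exp (-(t c + n))) • u + n • v) (by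
      simp [hu1, hu2, ht, hfv0]
      linarith)
    have h2 := hga c hc
    have h3 : (s - f c) * g u ≤ η * |g u| := by
      have := hs c hc
      calc (s - f c) * g u ≤ (s - f c) * |g u| :=
            mul_le_mul_of_nonneg_left (le_abs_self _) (by linarith)
        _ ≤ η * |g u| := mul_le_mul_of_nonneg_right (by linarith) (abs_nonneg _)
    simp only [map_add, map_smul, smul_eq_mul] at h1
    nlinarith
  · refine ⟨(s + 1) • u, ?_⟩
    simp [hu1, hu2]
  · exact isClosed_le (by fun_prop) (by fun_prop)
  · intro x hx y hy p q hp hq hpq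
    simp only [Set.mem_setOf_eq] at *
    have := convexOn_exp.2 (Set.mem_univ (-(t x))) (Set.mem_univ (-(t y))) hp hq hpq
    simp only [smul_eq_mul] at this
    have e : -(t (p • x + q • y)) = p * -(t x) + q * -(t y) := by simp; ring
    rw [e]
    simp only [map_add, map_smul, smul_eq_mul]
    have e2 : s = p * s + q * s := by rw [← add_mul, hpq, one_mul]
    nlinarith [mul_le_mul_of_nonneg_left hx hp, mul_le_mul_of_nonneg_left hy hq]
  · rw [Set.disjoint_left]
    intro c hc hcD
    have := hs c hc
    have h2 := Real.exp_pos (-(t c))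
    simp only [Set.mem_setOf_eq] at hcD
    linarith

lemma part_interior {X : Type*} [NormedAddCommGroup X] [InnerProductSpace ℝ X]
    [CompleteSpace X]
    (C : Set X) (hne : C.Nonempty) (hcl : IsClosed C) (hconv : Convex ℝ C)
    (hsep : StrongSepProperty C) (v : X) (hv0 : v ≠ 0)
    (hv : ∀ c ∈ C, ∀ t : ℝ, 0 ≤ t → c + t • v ∈ C) : (interior C).Nonempty := by
  by_contra hint
  obtain ⟨q, hq⟩ := hne
  -- find a direction that misses every translate
  obtain ⟨y, hy⟩ : ∃ y : X, ∀ n m : ℕ, q + ((n : ℝ) + 1)⁻¹ • y + (m : ℝ) • v ∉ C := by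
    by_contra! h
    let φ : ℕ × ℕ → X → X := fun k y => q + ((k.1 : ℝ) + 1)⁻¹ • y + (k.2 : ℝ) • v
    obtain ⟨k, x, hx⟩ := nonempty_interior_of_iUnion_of_closed
      (f := fun k : ℕ × ℕ => φ k ⁻¹' C)
      (fun k => hcl.preimage (by fun_prop))
      (by
        rw [Set.eq_univ_iff_forall]
        intro y
        obtain ⟨n, m, hnm⟩ := h y
        exact Set.mem_iUnion.2 ⟨(n, m), hnm⟩)
    apply hint
    refine ⟨φ k x, ?_⟩
    rw [mem_interior_iff_mem_nhds] at hx ⊢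
    let ψ : X → X := fun z => ((k.1 : ℝ) + 1) • (z - q - (k.2 : ℝ) • v)
    have hk : ((k.1 : ℝ) + 1) ≠ 0 := by positivity
    have hψ : ψ (φ k x) = x := by
      simp only [ψ, φ]
      rw [show q + ((k.1 : ℝ) + 1)⁻¹ • x + (k.2 : ℝ) • v - q - (k.2 : ℝ) • v
        = ((k.1 : ℝ) + 1)⁻¹ • x by abel, smul_inv_smul₀ hk]
    have hφ : ∀ z, φ k (ψ z) = z := by
      intro z
      simp only [ψ, φ, inv_smul_smul₀ hk]
      abel
    have hc : Continuous ψ := by fun_prop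
    have h3 := hc.tendsto (φ k x)
    rw [hψ] at h3
    filter_upwards [h3 hx] with z hz
    have : φ k (ψ z) ∈ C := hz
    rwa [hφ] at this
  have hmiss : ∀ s > (0 : ℝ), ∀ t : ℝ, q + s • y + t • v ∉ C := by
    intro s hs t hmem
    obtain ⟨n, hn⟩ := exists_nat_one_div_lt hs
    rw [one_div] at hn
    obtain ⟨m, hm⟩ := exists_nat_ge (|t|)
    have ht := le_abs_self t
    have hl0 : 0 < ((n : ℝ) + 1)⁻¹ := by positivity
    set l := ((n : ℝ) + 1)⁻¹ with hl
    have h1 : q + s • y + (m : ℝ) • v ∈ C := by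
      have := hv _ hmem (m - t) (by linarith)
      convert this using 1
      module
    have h2 : q + (m : ℝ) • v ∈ C := hv q hq m (by positivity)
    have h3 := hconv h1 h2 (a := l / s) (b := 1 - l / s) (by positivity)
      (by rw [sub_nonneg, div_le_one hs]; exact hn.le) (by ring)
    apply hy n m
    convert h3 using 1
    rw [← hl]
    have e : l • y = (l / s) • s • y := by rw [smul_smul, div_mul_cancel₀ _ hs.ne']
    rw [e]
    module
  let L : ℝ × ℝ →ₗ[ℝ] X :=
    (LinearMap.fst ℝ ℝ ℝ).smulRight v + (LinearMap.snd ℝ ℝ ℝ).smulRight y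
  have hL : ∀ p, L p = p.1 • v + p.2 • y := fun p => rfl
  have hker : LinearMap.ker L = ⊥ := by
    rw [LinearMap.ker_eq_bot']
    rintro ⟨t, s⟩ h
    rw [hL] at h
    simp only at h
    have hs : s = 0 := by
      by_contra hs
      apply hmiss 1 one_pos (t / s)
      have : y = -(t / s) • v := by
        have h4 : s⁻¹ • (t • v + s • y) = 0 := by rw [h, smul_zero]
        rw [smul_add, inv_smul_smul₀ hs, smul_smul, inv_mul_eq_div] at h4
        rw [neg_smul]
        exact eq_neg_of_add_eq_zero_right h4
      rw [this]
      convert hq using 1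
      module
    subst hs
    simp only [zero_smul, add_zero, smul_eq_zero, hv0, or_false] at h
    simp [h]
  have hLemb := LinearMap.isClosedEmbedding_of_injective hker
  let S : Set (ℝ × ℝ) := {p | Real.exp (-p.1) ≤ p.2}
  have hScl : IsClosed S := isClosed_le (by fun_prop) (by fun_prop)
  have hSconv : Convex ℝ S := by
    intro x hx z hz a b ha hb hab
    simp only [S, Set.mem_setOf_eq] at *
    have := convexOn_exp.2 (Set.mem_univ (-x.1)) (Set.mem_univ (-z.1)) ha hb hab
    simp only [smul_eq_mul] at this
    simp only [Prod.fst_add, Prod.snd_add, Prod.smul_fst, Prod.smul_snd, smul_eq_mul]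
    have e : -(a * x.1 + b * z.1) = a * -x.1 + b * -z.1 := by ring
    rw [e]
    nlinarith [mul_le_mul_of_nonneg_left hx ha, mul_le_mul_of_nonneg_left hz hb]
  have hD := hsep ((fun x => q + x) '' (L '' S)) ?_ ?_ ?_ ?_
  · obtain ⟨g, -, a, b, hab, hga, hgb⟩ := hD
    obtain ⟨n, hn, hnb⟩ := exp_small (g y) 0 (η := b - a) (by linarith)
    have h1 := hgb _ ⟨_, ⟨(n, Real.exp (-n)), (le_refl _ : Real.exp (-n) ≤ _), rfl⟩, rfl⟩
    have h2 := hga _ (hv q hq n hn)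
    simp only [hL, map_add, map_smul, smul_eq_mul, zero_add] at h1 h2 hnb
    linarith
  · exact ⟨_, _, ⟨(0, 1), by simp [S], rfl⟩, rfl⟩
  · exact (Homeomorph.addLeft q).isClosedMap _ (hLemb.isClosedMap _ hScl)
  · exact (hSconv.linear_image L).translate q
  · rw [Set.disjoint_left]
    rintro _ hc ⟨_, ⟨p, hp, rfl⟩, rfl⟩
    apply hmiss p.2 (lt_of_lt_of_le (Real.exp_pos _) hp) p.1
    convert hc using 1
    simp only [hL]
    abel

lemma part_converse {X : Type*} [NormedAddCommGroup X] [InnerProductSpace ℝ X]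
    [CompleteSpace X]
    (C : Set X) (hne : C.Nonempty) (hcl : IsClosed C) (hconv : Convex ℝ C)
    (hint : (interior C).Nonempty)
    (hbar : barrierCone C = interior (barrierCone C) ∪ {0}) : StrongSepProperty C := by
  intro D hDne hDcl hDconv hdisj
  obtain ⟨f, u, hfC, hfD⟩ := geometric_hahn_banach_open hconv.interior isOpen_interior hDconv
    (hdisj.mono_left interior_subset)
  have hfC' : ∀ c ∈ C, f c ≤ u := by
    intro c hc
    have h1 : c ∈ closure (interior C) := by
      rw [hconv.closure_interior_eq_closure_of_nonempty_interior hint]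
      exact subset_closure hc
    have h2 : closure (interior C) ⊆ {x | f x ≤ u} :=
      closure_minimal (fun x hx => (hfC x hx).le) (isClosed_le (by fun_prop) (by fun_prop))
    exact h2 h1
  have hf0 : f ≠ 0 := by
    rintro rfl
    obtain ⟨a, ha⟩ := hint
    obtain ⟨d, hd⟩ := hDne
    have h1 := hfC a ha
    have h2 := hfD d hd
    simp at h1 h2
    linarith
  have hfint : f ∈ interior (barrierCone C) := by
    have : f ∈ barrierCone C := ⟨u, hfC'⟩
    rw [hbar] at this
    exact this.resolve_right hf0
  obtain ⟨M, hM, hMc⟩ := wellpos C f hfint u hfC'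
  have h0 : (0 : X) ∉ closure (D - C) := by
    intro h0
    obtain ⟨x, hx, hxlim⟩ := mem_closure_iff_seq_limit.1 h0
    choose d hd c hc hdc using fun n => Set.mem_sub.1 (hx n)
    obtain ⟨R, hR⟩ := (Metric.isBounded_range_of_tendsto _ hxlim).exists_norm_le
    have hR' : ∀ n, ‖x n‖ ≤ R := fun n => hR _ ⟨n, rfl⟩
    let U : Ultrafilter ℕ := Filter.hyperfilter ℕ
    have hU : (U : Filter ℕ) ≤ Filter.atTop := Nat.hyperfilter_le_atTop
    obtain ⟨v, hv⟩ := weak_limit U c (M * (1 + ‖f‖ * R)) (by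
      intro n
      refine (hMc _ (hc n)).trans (mul_le_mul_of_nonneg_left ?_ hM.le)
      have h1 := hfD _ (hd n)
      have h2 : f (x n) = f (d n) - f (c n) := by rw [← hdc n, map_sub]
      have h3 := (le_abs_self _).trans (f.le_opNorm (x n))
      have h4 := mul_le_mul_of_nonneg_left (hR' n) (norm_nonneg f)
      linarith)
    have hvC : v ∈ C := weak_closed U C hcl hconv c v (Filter.Eventually.of_forall hc) hv
    have hvD : v ∈ D := by
      refine weak_closed U D hDcl hDconv d v (Filter.Eventually.of_forall hd) fun g => ?_
      have h1 : Filter.Tendsto (fun n => g (x n)) U (nhds (g 0)) :=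
        ((g.continuous.tendsto 0).comp hxlim).mono_left hU
      have h2 := (hv g).add h1
      rw [map_zero, add_zero] at h2
      refine h2.congr fun n => ?_
      rw [← hdc n, map_sub]; ring
    exact Set.disjoint_left.1 hdisj hvC hvD
  obtain ⟨g, b, hg0, hgb⟩ := geometric_hahn_banach_point_closed (hDconv.sub hconv).closure
    isClosed_closure h0
  rw [map_zero] at hg0
  have hcd : ∀ c ∈ C, ∀ d ∈ D, g c + b ≤ g d := by
    intro c hc d hd
    have := hgb _ (subset_closure (Set.sub_mem_sub hd hc))
    rw [map_sub] at this
    linarith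
  obtain ⟨d0, hd0⟩ := hDne
  obtain ⟨c0, hc0⟩ := hne
  refine ⟨g, ?_, sSup (g '' C), sSup (g '' C) + b, by linarith, ?_, ?_⟩
  · rintro rfl
    have := hcd c0 hc0 d0 hd0
    simp at this
    linarith
  · intro c hc
    refine le_csSup ⟨g d0 - b, ?_⟩ ⟨c, hc, rfl⟩
    rintro _ ⟨c, hc, rfl⟩
    linarith [hcd c hc d0 hd0]
  · intro d hd
    have : sSup (g '' C) ≤ g d - b := csSup_le ⟨_, c0, hc0, rfl⟩ (by
      rintro _ ⟨c, hc, rfl⟩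
      linarith [hcd c hc d hd])
    linarith

/-- Let `X` be a real Hilbert space and `C ⊆ X` a nonempty unbounded closed
convex set satisfying (A) `Int barc(C) ≠ ∅` or (C) `C ⊆ B(0; r) + Z` for some `r > 0` and
finite-dimensional subspace `Z`. Then `C` has the strong separation property iff
`Int C ≠ ∅` and `barc(C) = Int barc(C) ∪ {0}`. -/
theorem statement12 {X : Type*} [NormedAddCommGroup X] [InnerProductSpace ℝ X]
    [CompleteSpace X]
    (C : Set X) (hne : C.Nonempty) (hcl : IsClosed C) (hconv : Convex ℝ C)
    (hunbdd : ¬ Bornology.IsBounded C)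
    (hcond :
      (interior (barrierCone C)).Nonempty ∨
      (∃ r > (0 : ℝ), ∃ Z : Submodule ℝ X, FiniteDimensional ℝ Z ∧
        C ⊆ Metric.ball (0 : X) r + (Z : Set X))) :
    StrongSepProperty C ↔
      (interior C).Nonempty ∧ barrierCone C = interior (barrierCone C) ∪ {0} := by
  constructor
  · intro hsep
    constructor
    · obtain ⟨v, hv0, -, hv⟩ := recession C hcl hconv hcond 0 (by
        intro n
        by_contra! h
        apply hunbdd
        refine isBounded_iff_forall_norm_le.2 ⟨(n : ℝ) + 1, fun c hc => ?_⟩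
        by_contra! hlt
        have := h c hc hlt.le
        simp only [ContinuousLinearMap.zero_apply] at this
        have h2 : 0 ≤ ‖c‖ / ((n : ℝ) + 1) := by positivity
        linarith)
      exact part_interior C hne hcl hconv hsep v hv0 hv
    · apply Set.Subset.antisymm
      · intro f hf
        by_cases hf0 : f = 0
        · exact Or.inr hf0
        left
        by_contra hfi
        obtain ⟨v, hv0, hfv, hv⟩ := recession C hcl hconv hcond f (by
          intro n
          by_contra! h
          apply hfi
          rw [mem_interior_iff_mem_nhds, Metric.mem_nhds_iff]
          have hn : (0:ℝ) < (n : ℝ) + 1 := by positivity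
          refine ⟨1 / ((n : ℝ) + 1), by positivity, fun g hg => ⟨‖g‖ * ((n : ℝ) + 1), ?_⟩⟩
          intro c hc
          rw [mem_ball_iff_norm] at hg
          rcases le_total ((n : ℝ) + 1) ‖c‖ with h1 | h1
          · have h2 := h c hc h1
            have h3 := (le_abs_self _).trans ((g - f).le_opNorm c)
            have h4 := mul_le_mul_of_nonneg_right hg.le (norm_nonneg c)
            rw [one_div_mul_eq_div] at h4
            simp only [ContinuousLinearMap.sub_apply] at h3
            have h5 : 0 ≤ ‖g‖ * ((n : ℝ) + 1) := by positivity
            linarith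
          · exact (le_abs_self _).trans ((g.le_opNorm c).trans
              (mul_le_mul_of_nonneg_left h1 (norm_nonneg _))))
        exact part_barrier C hne hsep f hf hf0 v hv0 hfv hv
      · rintro f (hf | rfl)
        · exact interior_subset hf
        · exact ⟨0, fun c _ => by simp⟩
  · rintro ⟨hint, hbar⟩
    exact part_converse C hne hcl hconv hint hbar
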